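/- (Monotone improvement and convergence of the expectation-maximization iterates, Theorem 2.1 iterated) Let π^{(1)} be any full-support policy. Given a full-support policy π^{(n)}, define W^{(n)} and Q^{0,(n)} by the backward recursion relative to the prior π^{(n)}, and set π^{(n+1)}_t(s,a) = π^{(n)}_t(s,a)·exp( Q^{0,(n)}_t(s,a) − W^{(n)}_t(s) ). Then every π^{(n)} is a full-support policy, the sequence of values J(π^{(n)}) is nondecreasing in n and bounded above by T·max_{s,a} R(s,a), and hence the sequence J(π^{(n)}) converges. -/

import Mathlib

/-- Probability of a trajectory `x` (index `i : Fin T` represents time `i+1`, so times run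
over `1,…,T`) under initial distribution `p₁`, transition kernel `P` and policy `q`:
`p_q(h) = p₁(s₁) · ∏_{t=1}^T q_t(s_t,a_t) · ∏_{t=2}^T P(s_{t−1},a_{t−1},s_t)`. -/
noncomputable def pTraj {S A : Type} (T : ℕ) (p₁ : S → ℝ) (P : S → A → S → ℝ)
    (q : ℕ → S → A → ℝ) (x : Fin T → S × A) : ℝ :=
  (if h0 : 0 < T then p₁ (x ⟨0, h0⟩).1 else 1) *
    (∏ i : Fin T, q (i.1 + 1) (x i).1 (x i).2) *
    ∏ i : Fin T, if hlt : i.1 + 1 < T then P (x i).1 (x i).2 (x ⟨i.1 + 1, hlt⟩).1 else 1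

/-- Return of a trajectory: `R(h) = ∑_{t=1}^T R(s_t,a_t)`. -/
noncomputable def ret {S A : Type} (T : ℕ) (R : S → A → ℝ) (x : Fin T → S × A) : ℝ :=
  ∑ i : Fin T, R (x i).1 (x i).2

/-- Value of a policy: `J(q) = ∑_h p_q(h)·R(h)`. -/
noncomputable def Jval {S A : Type} [Fintype S] [Fintype A] (T : ℕ) (p₁ : S → ℝ) (P : S → A → S → ℝ)
    (R : S → A → ℝ) (q : ℕ → S → A → ℝ) : ℝ :=
  ∑ x : Fin T → S × A, pTraj T p₁ P q x * ret T R x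

/-- KL-regularized objective of `q` relative to the prior `π`:
`L(q) = ∑_{h : p_q(h)>0} p_q(h)·(R(h) + ∑_{t=1}^T log(π_t(s_t,a_t)/q_t(s_t,a_t)))`. -/
noncomputable def Lval {S A : Type} [Fintype S] [Fintype A] (T : ℕ) (p₁ : S → ℝ) (P : S → A → S → ℝ)
    (R : S → A → ℝ) (π q : ℕ → S → A → ℝ) : ℝ :=
  ∑ x : Fin T → S × A,
    if 0 < pTraj T p₁ P q x then
      pTraj T p₁ P q x * (ret T R x +
        ∑ i : Fin T,
          Real.log (π (i.1 + 1) (x i).1 (x i).2 / q (i.1 + 1) (x i).1 (x i).2))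
    else 0

/-- `q` is a (nonstationary) policy for times `1,…,T`. -/
def IsPolicy {S A : Type} [Fintype A] (T : ℕ) (q : ℕ → S → A → ℝ) : Prop :=
  ∀ t ∈ Finset.Icc 1 T, ∀ s : S, (∀ a : A, 0 ≤ q t s a) ∧ (∑ a : A, q t s a) = 1

/-- `π` has full support: `π_t(s,a) > 0` for all `t,s,a`. -/
def FullSupport {S A : Type} (T : ℕ) (π : ℕ → S → A → ℝ) : Prop :=
  ∀ t ∈ Finset.Icc 1 T, ∀ (s : S) (a : A), 0 < π t s a

/-- `q` is absolutely continuous w.r.t. `π`: `q_t(s,a) > 0 → π_t(s,a) > 0`. -/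
def AbsCont {S A : Type} (T : ℕ) (q π : ℕ → S → A → ℝ) : Prop :=
  ∀ t ∈ Finset.Icc 1 T, ∀ (s : S) (a : A), 0 < q t s a → 0 < π t s a

/-- KL divergence on a finite type: `KL(u‖v) = ∑_{x : u(x)>0} u(x)·log(u(x)/v(x))`. -/
noncomputable def KL {X : Type} [Fintype X] (u v : X → ℝ) : ℝ :=
  ∑ x : X, if 0 < u x then u x * Real.log (u x / v x) else 0

/-- Expected return of the last `k` steps when they start at time `t` in the state `s`. -/
noncomputable def valueToGo {S A : Type} [Fintype S] [Fintype A] (P : S → A → S → ℝ)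
    (R : S → A → ℝ) (q : ℕ → S → A → ℝ) : ℕ → ℕ → S → ℝ
  | 0, _, _ => 0
  | k + 1, t, s => ∑ a, q t s a * (R s a + ∑ s', P s a s' * valueToGo P R q k (t + 1) s')

lemma pTraj_cons {S A : Type} (T : ℕ) (p : S → ℝ) (P : S → A → S → ℝ) (q : ℕ → S → A → ℝ)
    (y : S × A) (x : Fin T → S × A) :
    pTraj (T + 1) p P q (Fin.cons y x) =
      p y.1 * q 1 y.1 y.2 * pTraj T (P y.1 y.2) P (fun t => q (t + 1)) x := by
  cases T with
  | zero => simp [pTraj]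
  | succ T =>
    have h0 : (⟨1, by omega⟩ : Fin (T + 1 + 1)) = Fin.succ ⟨0, by omega⟩ := rfl
    have hlt : 1 < T + 1 + 1 := by omega
    have hcons (i : Fin (T + 1)) (h : i.1 + 1 + 1 < T + 1 + 1) :
        (Fin.cons y x : Fin (T + 1 + 1) → S × A) ⟨i.1 + 1 + 1, h⟩ = x ⟨i.1 + 1, by omega⟩ :=
      Fin.cons_succ (α := fun _ => S × A) y x ⟨i.1 + 1, by omega⟩
    unfold pTraj
    rw [Fin.prod_univ_succ, Fin.prod_univ_succ (n := T + 1)]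
    simp only [hcons, Fin.cons_succ, Fin.cons_zero, Fin.val_succ, Fin.val_zero, zero_add, h0, hlt,
      Fin.mk_zero, Nat.zero_lt_succ, dif_pos, add_lt_add_iff_right]
    ring

lemma ret_cons {S A : Type} (T : ℕ) (R : S → A → ℝ) (y : S × A) (x : Fin T → S × A) :
    ret (T + 1) R (Fin.cons y x) = R y.1 y.2 + ret T R x := by
  simp [ret, Fin.sum_univ_succ]

lemma sum_fin_succ_pi {X : Type} [Fintype X] (T : ℕ) (f : (Fin (T + 1) → X) → ℝ) :
    ∑ x, f x = ∑ y, ∑ x : Fin T → X, f (Fin.cons y x) := by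
  rw [← (Fin.consEquiv fun _ : Fin (T + 1) => X).sum_comp, Fintype.sum_prod_type]
  rfl

lemma IsPolicy.shift {S A : Type} [Fintype A] {T : ℕ} {q : ℕ → S → A → ℝ}
    (hq : IsPolicy (T + 1) q) : IsPolicy T (fun t => q (t + 1)) := by
  intro t ht
  rw [Finset.mem_Icc] at ht
  exact hq (t + 1) (Finset.mem_Icc.2 ⟨by omega, by omega⟩)

lemma sum_pTraj {S A : Type} [Fintype S] [Fintype A] (P : S → A → S → ℝ)
    (hPsum : ∀ s a, (∑ s' : S, P s a s') = 1) (T : ℕ) (p : S → ℝ) (hp : (∑ s, p s) = 1)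
    (q : ℕ → S → A → ℝ) (hq : IsPolicy T q) : ∑ x, pTraj T p P q x = 1 := by
  induction T generalizing p q with
  | zero => simp [pTraj]
  | succ T ih =>
    have hq1 (s : S) : ∑ a, q 1 s a = 1 := (hq 1 (Finset.mem_Icc.2 ⟨le_rfl, by omega⟩) s).2
    simp only [sum_fin_succ_pi, pTraj_cons, ← Finset.mul_sum, ih _ (hPsum _ _) _ hq.shift,
      Fintype.sum_prod_type, mul_one, hq1, hp]

lemma valueToGo_shift {S A : Type} [Fintype S] [Fintype A] (P : S → A → S → ℝ)
    (R : S → A → ℝ) (q : ℕ → S → A → ℝ) (k t : ℕ) :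
    valueToGo P R (fun t => q (t + 1)) k t = valueToGo P R q k (t + 1) := by
  induction k generalizing t with
  | zero => rfl
  | succ k ih =>
    funext s
    simp only [valueToGo, ih]

lemma Jval_eq_sum_valueToGo {S A : Type} [Fintype S] [Fintype A] (P : S → A → S → ℝ)
    (hPsum : ∀ s a, (∑ s' : S, P s a s') = 1) (R : S → A → ℝ) (T : ℕ) (p : S → ℝ)
    (q : ℕ → S → A → ℝ) (hq : IsPolicy T q) :
    Jval T p P R q = ∑ s, p s * valueToGo P R q T 1 s := by
  induction T generalizing p q with
  | zero => simp [Jval, ret, valueToGo]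
  | succ T ih =>
    have hrec (y : S × A) : ∑ x : Fin T → S × A,
        p y.1 * q 1 y.1 y.2 * pTraj T (P y.1 y.2) P (fun t => q (t + 1)) x *
          (R y.1 y.2 + ret T R x) =
        p y.1 * (q 1 y.1 y.2 *
          (R y.1 y.2 + ∑ s', P y.1 y.2 s' * valueToGo P R q T (1 + 1) s')) := by
      have hJ := ih (P y.1 y.2) _ hq.shift
      rw [valueToGo_shift, Jval] at hJ
      rw [← hJ]
      simp only [mul_assoc, ← Finset.mul_sum, mul_add, Finset.sum_add_distrib, ← Finset.sum_mul,
        sum_pTraj P hPsum T _ (hPsum _ _) _ hq.shift, one_mul]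
    simp only [Jval, sum_fin_succ_pi, pTraj_cons, ret_cons, hrec, Fintype.sum_prod_type,
      valueToGo, Finset.mul_sum]

lemma valueToGo_le {S A : Type} [Fintype S] [Fintype A] {P : S → A → S → ℝ}
    (hP : ∀ s a s', 0 ≤ P s a s') (hPsum : ∀ s a, (∑ s' : S, P s a s') = 1) {R : S → A → ℝ}
    {M : ℝ} (hM : ∀ s a, R s a ≤ M) {T : ℕ} {q : ℕ → S → A → ℝ} (hq : IsPolicy T q)
    (k t : ℕ) (ht : 1 ≤ t) (hkt : k + t = T + 1) (s : S) :
    valueToGo P R q k t s ≤ k * M := by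
  induction k generalizing t s with
  | zero => simp [valueToGo]
  | succ k ih =>
    obtain ⟨hq0, hq1⟩ := hq t (Finset.mem_Icc.2 ⟨ht, by omega⟩) s
    calc valueToGo P R q (k + 1) t s
        ≤ ∑ a, q t s a * (M + ∑ s', P s a s' * (k * M)) := by
          unfold valueToGo
          gcongr with a _ s' _
          · exact hq0 a
          · exact hM s a
          · exact hP s a s'
          · exact ih (t + 1) (by omega) (by omega) s'
      _ = (k + 1 : ℕ) * M := by
          simp only [← Finset.sum_mul, hPsum, hq1]
          push_cast
          ring

lemma sum_mul_exp_sub_log_sum_exp {A : Type} [Fintype A] [Nonempty A] {u : A → ℝ}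
    (hu : ∀ a, 0 < u a) (Q : A → ℝ) :
    ∑ a, u a * Real.exp (Q a - Real.log (∑ b, u b * Real.exp (Q b))) = 1 := by
  have hpos : 0 < ∑ b, u b * Real.exp (Q b) :=
    Finset.sum_pos (fun b _ => mul_pos (hu b) (Real.exp_pos _)) Finset.univ_nonempty
  simp only [Real.exp_sub, Real.exp_log hpos, ← mul_div_assoc, ← Finset.sum_div]
  exact div_self hpos.ne'

lemma sum_mul_le_of_sum_mul_exp_sub_eq_one {A : Type} [Fintype A] {u Q : A → ℝ} {w : ℝ}
    (hu : ∀ a, 0 ≤ u a) (hu1 : ∑ a, u a = 1) (h : ∑ a, u a * Real.exp (Q a - w) = 1) :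
    ∑ a, u a * Q a ≤ w := by
  have key : ∑ a, u a * (Q a - w + 1) ≤ ∑ a, u a * Real.exp (Q a - w) :=
    Finset.sum_le_sum fun a _ => mul_le_mul_of_nonneg_left (Real.add_one_le_exp _) (hu a)
  simp only [mul_add, mul_sub, Finset.sum_add_distrib, Finset.sum_sub_distrib, ← Finset.sum_mul,
    hu1, h] at key
  linarith

lemma le_sum_mul_exp_sub_mul {A : Type} [Fintype A] {u Q : A → ℝ} {w : ℝ}
    (hu : ∀ a, 0 ≤ u a) (hu1 : ∑ a, u a = 1) (h : ∑ a, u a * Real.exp (Q a - w) = 1) :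
    w ≤ ∑ a, u a * Real.exp (Q a - w) * Q a := by
  have hexp (x : ℝ) : Real.exp x - 1 ≤ Real.exp x * x := by
    have h1 : Real.exp x * (-x + 1) ≤ Real.exp x * Real.exp (-x) :=
      mul_le_mul_of_nonneg_left (Real.add_one_le_exp _) (Real.exp_pos x).le
    rw [← Real.exp_add, add_neg_cancel, Real.exp_zero] at h1
    linarith
  have key : ∑ a, u a * (Real.exp (Q a - w) - 1) ≤
      ∑ a, u a * (Real.exp (Q a - w) * (Q a - w)) :=
    Finset.sum_le_sum fun a _ => mul_le_mul_of_nonneg_left (hexp _) (hu a)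
  simp only [← mul_assoc, mul_sub, Finset.sum_sub_distrib, ← Finset.sum_mul, hu1, h,
    mul_one] at key
  linarith

/-- The soft value function `W` relative to a prior `π` lies between the values of `π` and of the
exponentially tilted policy `π'`. -/
lemma valueToGo_le_soft_le_valueToGo {S A : Type} [Fintype S] [Fintype A] {T : ℕ}
    {P : S → A → S → ℝ} (hP : ∀ s a s', 0 ≤ P s a s') {R : S → A → ℝ}
    {π π' : ℕ → S → A → ℝ} (hπ : IsPolicy T π) (hπ' : IsPolicy T π')
    {W : ℕ → S → ℝ} {Q : ℕ → S → A → ℝ} (hWT : ∀ s, W (T + 1) s = 0)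
    (hQ : ∀ t ∈ Finset.Icc 1 T, ∀ s a, Q t s a = R s a + ∑ s', P s a s' * W (t + 1) s')
    (hstep : ∀ t ∈ Finset.Icc 1 T, ∀ s a, π' t s a = π t s a * Real.exp (Q t s a - W t s))
    (k t : ℕ) (ht : 1 ≤ t) (hkt : k + t = T + 1) (s : S) :
    valueToGo P R π k t s ≤ W t s ∧ W t s ≤ valueToGo P R π' k t s := by
  induction k generalizing t s with
  | zero =>
    obtain rfl : t = T + 1 := by omega
    simp [valueToGo, hWT]
  | succ k ih =>
    have hmem : t ∈ Finset.Icc 1 T := Finset.mem_Icc.2 ⟨ht, by omega⟩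
    obtain ⟨hπ0, hπ1⟩ := hπ t hmem s
    obtain ⟨hπ'0, hπ'1⟩ := hπ' t hmem s
    have hih := ih (t + 1) (by omega) (by omega)
    have hexp : ∑ a, π t s a * Real.exp (Q t s a - W t s) = 1 := by
      simpa only [hstep t hmem] using hπ'1
    constructor
    · refine le_trans ?_ (sum_mul_le_of_sum_mul_exp_sub_eq_one hπ0 hπ1 hexp)
      unfold valueToGo
      simp only [hQ t hmem]
      gcongr with a _ s' _
      · exact hπ0 a
      · exact hP s a s'
      · exact (hih s').1
    · refine (le_sum_mul_exp_sub_mul hπ0 hπ1 hexp).trans ?_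
      simp only [← hstep t hmem]
      unfold valueToGo
      simp only [hQ t hmem]
      gcongr with a _ s' _
      · exact hπ'0 a
      · exact hP s a s'
      · exact (hih s').2

/-- Monotone improvement and convergence of the EM iterates: starting from a
full-support policy `π⁽⁰⁾` and iterating `π⁽ⁿ⁺¹⁾_t(s,a) = π⁽ⁿ⁾_t(s,a)·exp(Q⁰⁽ⁿ⁾_t(s,a) −
W⁽ⁿ⁾_t(s))`, every iterate is a full-support policy, the values `J(π⁽ⁿ⁾)` are nondecreasing and
bounded above by `T·max_{s,a} R(s,a)`, and hence converge. -/
theorem stmt_16 {S A : Type} [Fintype S] [Fintype A] [Nonempty S] [Nonempty A]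
    (T : ℕ) (hT : 1 ≤ T)
    (p₁ : S → ℝ) (hp₁ : ∀ s, 0 ≤ p₁ s) (hp₁sum : (∑ s : S, p₁ s) = 1)
    (P : S → A → S → ℝ) (hP : ∀ s a s', 0 ≤ P s a s')
    (hPsum : ∀ s a, (∑ s' : S, P s a s') = 1)
    (R : S → A → ℝ)
    (π : ℕ → ℕ → S → A → ℝ)
    (hπ0 : IsPolicy T (π 0)) (hπ0pos : FullSupport T (π 0))
    (W : ℕ → ℕ → S → ℝ) (Q0 : ℕ → ℕ → S → A → ℝ)
    (hWT : ∀ (n : ℕ) (s : S), W n (T + 1) s = 0)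
    (hQ0 : ∀ n : ℕ, ∀ t ∈ Finset.Icc 1 T, ∀ (s : S) (a : A),
      Q0 n t s a = R s a + ∑ s' : S, P s a s' * W n (t + 1) s')
    (hW : ∀ n : ℕ, ∀ t ∈ Finset.Icc 1 T, ∀ s : S,
      W n t s = Real.log (∑ a : A, π n t s a * Real.exp (Q0 n t s a)))
    (hstep : ∀ n : ℕ, ∀ t ∈ Finset.Icc 1 T, ∀ (s : S) (a : A),
      π (n + 1) t s a = π n t s a * Real.exp (Q0 n t s a - W n t s)) :
    (∀ n : ℕ, IsPolicy T (π n) ∧ FullSupport T (π n)) ∧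
      (∀ n : ℕ, Jval T p₁ P R (π n) ≤ Jval T p₁ P R (π (n + 1))) ∧
      (∀ n : ℕ, Jval T p₁ P R (π n) ≤
        (T : ℝ) * Finset.univ.sup' Finset.univ_nonempty (fun sa : S × A => R sa.1 sa.2)) ∧
      (∃ l : ℝ, Filter.Tendsto (fun n => Jval T p₁ P R (π n)) Filter.atTop (nhds l)) := by
  have hpol (n : ℕ) : IsPolicy T (π n) ∧ FullSupport T (π n) := by
    induction n with
    | zero => exact ⟨hπ0, hπ0pos⟩
    | succ n ih =>
      have hpos : FullSupport T (π (n + 1)) := fun t ht s a => by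
        rw [hstep n t ht]
        exact mul_pos (ih.2 t ht s a) (Real.exp_pos _)
      refine ⟨fun t ht s => ⟨fun a => (hpos t ht s a).le, ?_⟩, hpos⟩
      simp only [hstep n t ht, hW n t ht]
      exact sum_mul_exp_sub_log_sum_exp (ih.2 t ht s) _
  have hJ (n : ℕ) := Jval_eq_sum_valueToGo P hPsum R T p₁ (π n) (hpol n).1
  have hmono (n : ℕ) : Jval T p₁ P R (π n) ≤ Jval T p₁ P R (π (n + 1)) := by
    rw [hJ, hJ]
    refine Finset.sum_le_sum fun s _ => mul_le_mul_of_nonneg_left ?_ (hp₁ s)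
    have hs := valueToGo_le_soft_le_valueToGo hP (hpol n).1 (hpol (n + 1)).1 (hWT n) (hQ0 n)
      (hstep n) T 1 le_rfl rfl s
    exact hs.1.trans hs.2
  have hbound (n : ℕ) : Jval T p₁ P R (π n) ≤
      (T : ℝ) * Finset.univ.sup' Finset.univ_nonempty (fun sa : S × A => R sa.1 sa.2) := by
    have hR (s : S) (a : A) : R s a ≤
        Finset.univ.sup' Finset.univ_nonempty (fun sa : S × A => R sa.1 sa.2) :=
      Finset.le_sup' (fun sa : S × A => R sa.1 sa.2) (Finset.mem_univ (s, a))
    rw [hJ]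
    refine (Finset.sum_le_sum fun s _ => mul_le_mul_of_nonneg_left
      (valueToGo_le hP hPsum hR (hpol n).1 T 1 le_rfl rfl s) (hp₁ s)).trans_eq ?_
    rw [← Finset.sum_mul, hp₁sum, one_mul]
  exact ⟨hpol, hmono, hbound, _, tendsto_atTop_ciSup (monotone_nat_of_le_succ hmono)
    ⟨_, Set.forall_mem_range.2 hbound⟩⟩
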